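/- Let X and Y be finite sets of points in the plane with the l∞ norm, κ : X → ℕ with 1 ≤ κ(x) ≤ |Y| for all x ∈ X, and let r' : Y → ℝ≥0 be an assignment under which every x ∈ X is κ(x)-covered. Let X' ⊆ X, and let D = {(y, r'(y)) : y ∈ Y} be the corresponding disks. Then there exists a subfamily D_κ ⊆ D whose disks are pairwise disjoint, such that: (i) under the disks D \ D_κ, every x ∈ X is at least (κ(x) − 1)-covered; and (ii) for every x ∈ X' there exists (y, s) ∈ D_κ with ‖x − y‖∞ ≤ 3·s and 3·s ≥ dκ(x) (i.e., the disks of D_κ enlarged by a factor 3 form an outer cover for X'). -/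

import Mathlib

/-- The κ-th smallest value (1-indexed) in the multiset `{‖x - y‖_∞ : y ∈ Y}`,
where points of the plane are modeled as `Fin 2 → ℝ` whose norm is the sup (l∞) norm. -/
noncomputable def kthDist (Y : Finset (Fin 2 → ℝ)) (x : Fin 2 → ℝ) (k : ℕ) : ℝ :=
  ((Y.val.map fun y => ‖x - y‖).sort (· ≤ ·)).getD (k - 1) 0

/-- If at least `k ≥ 1` points of `Y` lie within distance `R` of `x`, then the `k`-th smallest
distance from `x` to `Y` is at most `R`. -/
theorem kthDist_le_of_le_card {Y : Finset (Fin 2 → ℝ)} {x : Fin 2 → ℝ} {k : ℕ} {R : ℝ}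
    (hk : 1 ≤ k) (h : k ≤ (Y.filter fun y => ‖x - y‖ ≤ R).card) : kthDist Y x k ≤ R := by
  unfold kthDist
  set l := (Y.val.map fun y => ‖x - y‖).sort (· ≤ ·) with hl
  have hcount : l.countP (· ≤ R) = (Y.filter fun y => ‖x - y‖ ≤ R).card := by
    rw [← Multiset.coe_countP, hl, Multiset.sort_eq, Multiset.countP_map]
    rfl
  have hlen : k - 1 < l.length := by
    have := List.countP_le_length (p := fun a => decide (a ≤ R)) (l := l)
    omega
  have hsorted : l.Pairwise (· ≤ ·) := Multiset.pairwise_sort _ _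
  rw [List.getD_eq_getElem _ _ hlen]
  by_contra! hR
  have hdrop : (l.drop (k - 1)).countP (· ≤ R) = 0 := by
    rw [List.countP_eq_zero]
    intro a ha
    obtain ⟨i, hi, rfl⟩ := List.mem_iff_getElem.1 ha
    rw [List.getElem_drop]
    have : l[k - 1] ≤ l[k - 1 + i]'(by rw [List.length_drop] at hi; omega) :=
      hsorted.sortedLE.getElem_le_getElem_of_le (by omega)
    simpa using hR.trans_le this
  have hsplit := List.countP_append (p := fun a => decide (a ≤ R))
    (l₁ := l.take (k - 1)) (l₂ := l.drop (k - 1))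
  rw [List.take_append_drop, hdrop] at hsplit
  have htake := List.countP_le_length (p := fun a => decide (a ≤ R)) (l := l.take (k - 1))
  rw [List.length_take] at htake
  omega

open scoped Classical in
/-- Greedy selection by decreasing weight: a finite family of sets has a pairwise disjoint
subfamily such that every nonempty member meets a selected one of at least its weight. -/
theorem exists_disjoint_subfamily_meeting_larger {ι α : Type*} (B : ι → Set α) (r : ι → ℝ)
    (Y : Finset ι) :
    ∃ S ⊆ Y, (S : Set ι).Pairwise (fun i j => Disjoint (B i) (B j)) ∧
      ∀ y ∈ Y, (B y).Nonempty → ∃ s ∈ S, r y ≤ r s ∧ ¬ Disjoint (B y) (B s) := by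
  induction Y using Finset.induction_on_min_value r with
  | empty => exact ⟨∅, by simp⟩
  | insert a Y _ hmin ih =>
    obtain ⟨S, hSY, hdisj, hmeet⟩ := ih
    by_cases ha : ∃ s ∈ S, ¬ Disjoint (B a) (B s)
    · refine ⟨S, hSY.trans (Finset.subset_insert _ _), hdisj, fun y hy hne => ?_⟩
      rcases Finset.mem_insert.1 hy with rfl | hy
      · obtain ⟨s, hs, hys⟩ := ha
        exact ⟨s, hs, hmin s (hSY hs), hys⟩
      · exact hmeet y hy hne
    · push Not at ha
      refine ⟨insert a S, Finset.insert_subset_insert _ hSY, ?_, fun y hy hne => ?_⟩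
      · rw [Finset.coe_insert]
        exact hdisj.insert fun s hs _ => ⟨ha s hs, (ha s hs).symm⟩
      · rcases Finset.mem_insert.1 hy with rfl | hy
        · exact ⟨y, Finset.mem_insert_self _ _, le_rfl,
            fun h => hne.ne_empty (disjoint_self.1 h)⟩
        · obtain ⟨s, hs, h⟩ := hmeet y hy hne
          exact ⟨s, Finset.mem_insert_of_mem hs, h⟩

open scoped Classical in
theorem stmt12 (X Y : Finset (Fin 2 → ℝ)) (κ : (Fin 2 → ℝ) → ℕ)
    (hκ : ∀ x ∈ X, 1 ≤ κ x ∧ κ x ≤ Y.card)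
    (r' : (Fin 2 → ℝ) → ℝ) (hr' : ∀ y ∈ Y, 0 ≤ r' y)
    (hcov : ∀ x ∈ X, κ x ≤ (Y.filter fun y => ‖x - y‖ ≤ r' y).card)
    (X' : Finset (Fin 2 → ℝ)) (hX' : X' ⊆ X) :
    ∃ S ⊆ Y,
      ((S : Set (Fin 2 → ℝ)).Pairwise fun y₁ y₂ =>
        Disjoint (Metric.closedBall y₁ (r' y₁)) (Metric.closedBall y₂ (r' y₂))) ∧
      (∀ x ∈ X, κ x - 1 ≤ ((Y \ S).filter fun y => ‖x - y‖ ≤ r' y).card) ∧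
      (∀ x ∈ X', ∃ y ∈ S, ‖x - y‖ ≤ 3 * r' y ∧ kthDist Y x (κ x) ≤ 3 * r' y) := by
  obtain ⟨S, hSY, hdisj, hmeet⟩ :=
    exists_disjoint_subfamily_meeting_larger (fun y => Metric.closedBall y (r' y)) r' Y
  refine ⟨S, hSY, hdisj, fun x hx => ?_, fun x hx => ?_⟩
  · have hone : (S.filter fun y => ‖x - y‖ ≤ r' y).card ≤ 1 := by
      refine Finset.card_le_one.2 fun a ha b hb => ?_
      rw [Finset.mem_filter, ← mem_closedBall_iff_norm] at ha hb
      by_contra hab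
      exact Set.disjoint_left.1 (hdisj ha.1 hb.1 hab) ha.2 hb.2
    have hsplit : (Y.filter fun y => ‖x - y‖ ≤ r' y).card ≤
        ((Y \ S).filter fun y => ‖x - y‖ ≤ r' y).card +
          (S.filter fun y => ‖x - y‖ ≤ r' y).card := by
      rw [← Finset.sdiff_union_of_subset hSY, Finset.filter_union,
        Finset.sdiff_union_of_subset hSY]
      exact Finset.card_union_le _ _
    have := hcov x hx
    omega
  · have hκx := (hκ x (hX' hx)).1
    have hcovx := hcov x (hX' hx)
    obtain ⟨y, hy, hmax⟩ := Finset.exists_max_image (Y.filter fun y => ‖x - y‖ ≤ r' y) r'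
      (Finset.card_pos.1 (by omega))
    obtain ⟨hyY, hxy⟩ := Finset.mem_filter.1 hy
    have hkth : kthDist Y x (κ x) ≤ r' y := by
      refine kthDist_le_of_le_card hκx (hcovx.trans (Finset.card_le_card fun z hz => ?_))
      obtain ⟨hzY, hxz⟩ := Finset.mem_filter.1 hz
      exact Finset.mem_filter.2 ⟨hzY, hxz.trans (hmax z hz)⟩
    obtain ⟨s, hs, hys, hnd⟩ := hmeet y hyY ⟨x, mem_closedBall_iff_norm.2 hxy⟩
    obtain ⟨z, hzy, hzs⟩ := Set.not_disjoint_iff.1 hnd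
    have hdist : dist x s ≤ dist x y + dist y z + dist z s := dist_triangle4 x y z s
    rw [Metric.mem_closedBall] at hzy hzs
    rw [dist_comm y z, dist_eq_norm x s, dist_eq_norm x y] at hdist
    have := hr' s (hSY hs)
    exact ⟨s, hs, by linarith, by linarith⟩
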